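/- arXiv:cs/0505022 — 2 statements merged into one kernel-verified Lean document; each statement's English description precedes it below -/
import Mathlib

section
/- Let N ≥ 1 be an integer and R̃ > 0. Define α(φ) = 4π R̃ sin(φ/2), the average beampattern P_av(φ) = 1/N + (1 − 1/N)(2 J₁(α(φ))/α(φ))², and S(x) = (1/π) ∫₀^π (2 J₁(x sin(θ/2)) / (x sin(θ/2)))² dθ. Then the average-beampattern directivity satisfies D̃_av := 2π / ∫_{−π}^{π} P_av(φ) dφ = N / (1 + (N − 1) · S(4π R̃)). -/
open MeasureTheory ProbabilityTheory Real Filter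

/-- Bessel function of the first kind of integer order `n`:
`Jₙ(x) = (1/π) ∫₀^π cos(nθ − x sin θ) dθ`. -/
noncomputable def besselJ (n : ℕ) (x : ℝ) : ℝ :=
  (1 / π) * ∫ θ in (0:ℝ)..π, Real.cos (n * θ - x * Real.sin θ)

/-- The semicircle probability measure on ℝ, with density `(2/π)√(1 − z²)` on `[−1,1]`. -/
noncomputable def semicircleMeasure : Measure ℝ :=
  volume.withDensity (fun z => ENNReal.ofReal
    (if z ∈ Set.Icc (-1 : ℝ) 1 then (2 / π) * Real.sqrt (1 - z ^ 2) else 0))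

/-- `S(x) = (1/π) ∫₀^π (2J₁(x sin(θ/2)) / (x sin(θ/2)))² dθ`. -/
noncomputable def sidelobeIntegral (x : ℝ) : ℝ :=
  (1 / π) * ∫ θ in (0:ℝ)..π,
    (2 * besselJ 1 (x * Real.sin (θ / 2)) / (x * Real.sin (θ / 2))) ^ 2

lemma bj_odd (x : ℝ) : besselJ 1 (-x) = -besselJ 1 x := by
  unfold besselJ
  rw [← mul_neg, ← intervalIntegral.integral_neg]
  congr 1
  have h := intervalIntegral.integral_comp_sub_left
    (fun θ : ℝ => Real.cos ((1:ℕ) * θ - (-x) * Real.sin θ)) (a := 0) (b := π) π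
  simp only [sub_self, sub_zero] at h
  rw [← h]
  apply intervalIntegral.integral_congr
  intro θ _
  simp only [Real.sin_pi_sub]
  rw [← Real.cos_pi_sub]
  congr 1
  push_cast
  ring

lemma bj_cont : Continuous (besselJ 1) := by
  unfold besselJ
  apply Continuous.mul continuous_const
  apply intervalIntegral.continuous_parametric_intervalIntegral_of_continuous'
  unfold Function.uncurry
  fun_prop

lemma bj_bound (x : ℝ) : |besselJ 1 x| ≤ |x| := by
  have h0 : ∫ θ in (0:ℝ)..π, Real.cos θ = 0 := by simp
  have h : (∫ θ in (0:ℝ)..π, Real.cos ((1:ℕ) * θ - x * Real.sin θ))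
      = ∫ θ in (0:ℝ)..π, (Real.cos ((1:ℕ) * θ - x * Real.sin θ) - Real.cos θ) := by
    rw [intervalIntegral.integral_sub, h0, sub_zero]
    · exact Continuous.intervalIntegrable (by fun_prop) _ _
    · exact Continuous.intervalIntegrable (by fun_prop) _ _
  have hb := intervalIntegral.norm_integral_le_of_norm_le_const (a := 0) (b := π) (C := |x|)
    (f := fun θ : ℝ => Real.cos ((1:ℕ) * θ - x * Real.sin θ) - Real.cos θ) (by
      intro θ _
      have h1 := Real.lipschitzWith_cos.dist_le_mul ((1:ℕ) * θ - x * Real.sin θ) θ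
      rw [Real.dist_eq, Real.dist_eq] at h1
      rw [Real.norm_eq_abs]
      refine h1.trans ?_
      have : ((1:ℕ):ℝ) * θ - x * Real.sin θ - θ = -(x * Real.sin θ) := by push_cast; ring
      rw [this, abs_neg, abs_mul]
      have := Real.abs_sin_le_one θ
      have := abs_nonneg x
      simp only [NNReal.coe_one, one_mul]
      nlinarith)
  unfold besselJ
  rw [h, abs_mul]
  rw [Real.norm_eq_abs, sub_zero, abs_of_pos Real.pi_pos] at hb
  have hp := Real.pi_pos
  rw [abs_of_pos (by positivity : (0:ℝ) < 1 / π), div_mul_eq_mul_div, one_mul, div_le_iff₀ hp]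
  exact hb

lemma bj_int (c a b : ℝ) : IntervalIntegrable (fun φ : ℝ =>
    (2 * besselJ 1 (c * Real.sin (φ / 2)) / (c * Real.sin (φ / 2))) ^ 2) volume a b := by
  have hm : Measurable (fun φ : ℝ =>
    (2 * besselJ 1 (c * Real.sin (φ / 2)) / (c * Real.sin (φ / 2))) ^ 2) := by
    have := bj_cont.measurable
    fun_prop
  refine (intervalIntegrable_const (c := (4:ℝ))).mono_fun hm.aestronglyMeasurable ?_
  refine Eventually.of_forall fun φ => ?_
  set y := c * Real.sin (φ / 2)
  have h : |2 * besselJ 1 y / y| ≤ 2 := by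
    rw [abs_div, abs_mul, abs_two]
    apply div_le_of_le_mul₀ (abs_nonneg _) (by norm_num)
    linarith [bj_bound y]
  simp only [Real.norm_eq_abs]
  rw [abs_pow, abs_of_pos (by norm_num : (0:ℝ) < 4)]
  nlinarith [abs_nonneg (2 * besselJ 1 y / y)]

lemma bj_sym (c : ℝ) : (∫ φ in (-π)..π,
    (2 * besselJ 1 (c * Real.sin (φ / 2)) / (c * Real.sin (φ / 2))) ^ 2)
    = 2 * π * sidelobeIntegral c := by
  rw [← intervalIntegral.integral_add_adjacent_intervals (bj_int c (-π) 0) (bj_int c 0 π)]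
  have h := intervalIntegral.integral_comp_neg (a := 0) (b := π) (fun φ : ℝ =>
    (2 * besselJ 1 (c * Real.sin (φ / 2)) / (c * Real.sin (φ / 2))) ^ 2)
  rw [neg_zero] at h
  rw [← h]
  have : ∀ φ : ℝ, (2 * besselJ 1 (c * Real.sin (-φ / 2)) / (c * Real.sin (-φ / 2))) ^ 2
      = (2 * besselJ 1 (c * Real.sin (φ / 2)) / (c * Real.sin (φ / 2))) ^ 2 := by
    intro φ
    rw [neg_div, Real.sin_neg, mul_neg, bj_odd, mul_neg, neg_div_neg_eq]
  simp only [this]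
  unfold sidelobeIntegral
  have := Real.pi_ne_zero
  field_simp
  ring

/-- The average-beampattern directivity satisfies
`D̃_av = 2π / ∫_{−π}^{π} P_av(φ) dφ = N / (1 + (N−1) S(4πR̃))`, where
`P_av(φ) = 1/N + (1 − 1/N)(2J₁(α(φ))/α(φ))²` with `α(φ) = 4πR̃ sin(φ/2)`. -/
theorem average_directivity_formula (N : ℕ) (hN : 1 ≤ N) (R : ℝ) (hR : 0 < R) :
    (2 * π) / (∫ φ in (-π)..π,
        (1 / N + (1 - 1 / (N : ℝ)) *
          (2 * besselJ 1 (4 * π * R * Real.sin (φ / 2)) / (4 * π * R * Real.sin (φ / 2))) ^ 2))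
      = N / (1 + ((N : ℝ) - 1) * sidelobeIntegral (4 * π * R)) := by
  have hN' : (N : ℝ) ≠ 0 := by positivity
  rw [intervalIntegral.integral_add intervalIntegrable_const ((bj_int _ _ _).const_mul _),
    intervalIntegral.integral_const_mul, bj_sym, intervalIntegral.integral_const]
  have hp := Real.pi_ne_zero
  have e : (π - -π) • (1 / (N : ℝ)) + (1 - 1 / (N : ℝ)) * (2 * π * sidelobeIntegral (4 * π * R))
      = (2 * π) * ((1 + ((N : ℝ) - 1) * sidelobeIntegral (4 * π * R)) / N) := by
    rw [smul_eq_mul]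
    field_simp
    ring
  rw [e, div_mul_eq_div_div, div_self (by positivity), one_div_div]
end

section
/- Let r_max > 0, let δr be uniformly distributed on [−r_max, r_max], and let θ be uniformly distributed on [0, 2π], independent of δr. Then the random variable V = δr · cos(θ) has probability density f_V(v) = (1/(π r_max)) · [ ln(1 + √(1 − (v/r_max)²)) − ln(|v|/r_max) ] for 0 < |v| ≤ r_max (and 0 for |v| > r_max). -/
open MeasureTheory ProbabilityTheory Real Filter

lemma aux_ae_cos : ∀ᵐ t : ℝ, Real.cos t ≠ 0 := by
  have hc : ({t : ℝ | Real.cos t = 0}).Countable := by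
    refine (Set.countable_range (fun k : ℤ => (2 * (k:ℝ) + 1) * π / 2)).mono ?_
    intro t ht
    obtain ⟨k, hk⟩ := Real.cos_eq_zero_iff.1 ht
    exact ⟨k, hk.symm⟩
  exact measure_eq_zero_iff_ae_notMem.1 (hc.measure_zero volume)

lemma aux_scale (c : ℝ) (hc : c ≠ 0) (F : ℝ → ENNReal) (hF : Measurable F) :
    ∫⁻ r, F (r * c) = ∫⁻ v, ENNReal.ofReal |c⁻¹| * F v := by
  have hm : Measurable fun r : ℝ => r * c := by fun_prop
  rw [lintegral_const_mul _ hF, ← lintegral_map hF hm, Real.map_volume_mul_right hc, lintegral_smul_measure, smul_eq_mul]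

/-- The truncated secant. -/
noncomputable def auxg (a t : ℝ) : ℝ := if a ≤ |Real.cos t| then |Real.cos t|⁻¹ else 0

lemma auxg_meas (a : ℝ) : Measurable (auxg a) := by
  unfold auxg
  refine Measurable.ite (measurableSet_le (by fun_prop) (by fun_prop)) (by fun_prop) (by fun_prop)

lemma auxg_nonneg (a t : ℝ) : 0 ≤ auxg a t := by
  unfold auxg; split_ifs <;> positivity

lemma auxg_le (a t : ℝ) (ha : 0 < a) : auxg a t ≤ a⁻¹ := by
  unfold auxg; split_ifs with h
  · exact inv_anti₀ ha h
  · positivity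

lemma auxg_ii (a : ℝ) (ha : 0 < a) (x y : ℝ) : IntervalIntegrable (auxg a) volume x y := by
  refine (intervalIntegrable_const (c := a⁻¹)).mono_fun (auxg_meas a).aestronglyMeasurable ?_
  refine Eventually.of_forall fun t => ?_
  beta_reduce
  rw [Real.norm_of_nonneg (auxg_nonneg a t), Real.norm_of_nonneg (by positivity)]
  exact auxg_le a t ha

lemma auxg_quarter (a : ℝ) (ha : 0 < a) (ha1 : a ≤ 1) :
    ∫ t in (0:ℝ)..(π/2), auxg a t = Real.log (1 + Real.sqrt (1 - a ^ 2)) - Real.log a := by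
  have hα0 := Real.arccos_nonneg a
  have hα1 : Real.arccos a < π / 2 := Real.arccos_lt_pi_div_two.2 ha
  have hcα : Real.cos (Real.arccos a) = a := Real.cos_arccos (by linarith) ha1
  have hpi := Real.pi_pos
  rw [← intervalIntegral.integral_add_adjacent_intervals (auxg_ii a ha 0 (Real.arccos a))
    (auxg_ii a ha (Real.arccos a) (π/2))]
  have h2 : ∫ t in (Real.arccos a)..(π/2), auxg a t = 0 := by
    refine intervalIntegral.integral_zero_ae (Eventually.of_forall fun t ht => ?_)
    rw [Set.uIoc_of_le hα1.le] at ht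
    have h1 : Real.cos t < a := by
      rw [← hcα]
      exact Real.cos_lt_cos_of_nonneg_of_le_pi hα0 (by linarith [ht.2]) ht.1
    have h0 : 0 ≤ Real.cos t := Real.cos_nonneg_of_neg_pi_div_two_le_of_le (by linarith [ht.1]) ht.2
    unfold auxg
    rw [abs_of_nonneg h0, if_neg (not_le.2 h1)]
  rw [h2, add_zero]
  have hpos : ∀ t ∈ Set.uIcc 0 (Real.arccos a), a ≤ Real.cos t := by
    intro t ht
    rw [Set.uIcc_of_le hα0] at ht
    calc a = Real.cos (Real.arccos a) := hcα.symm
      _ ≤ Real.cos t := Real.cos_le_cos_of_nonneg_of_le_pi ht.1 (by linarith) ht.2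
  have hd : ∀ t ∈ Set.uIcc 0 (Real.arccos a), HasDerivAt
      (fun t => Real.log (1 + Real.sin t) - Real.log (Real.cos t)) (auxg a t) t := by
    intro t ht
    have h1 := hpos t ht
    have hc0 : 0 < Real.cos t := by linarith
    have hs : 0 < 1 + Real.sin t := by nlinarith [Real.sin_sq_add_cos_sq t, Real.neg_one_le_sin t]
    have := (((Real.hasDerivAt_sin t).const_add 1).log hs.ne').sub
      ((Real.hasDerivAt_cos t).log hc0.ne')
    refine this.congr_deriv ?_
    unfold auxg
    rw [abs_of_pos hc0, if_pos h1]
    field_simp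
    nlinarith [Real.sin_sq_add_cos_sq t]
  rw [intervalIntegral.integral_eq_sub_of_hasDerivAt hd (auxg_ii a ha _ _), hcα, Real.sin_arccos]
  simp

lemma auxg_full (a : ℝ) (ha : 0 < a) (ha1 : a ≤ 1) :
    ∫ t in (0:ℝ)..(2*π), auxg a t
      = 4 * (Real.log (1 + Real.sqrt (1 - a ^ 2)) - Real.log a) := by
  have hper : Function.Periodic (auxg a) π := by
    intro t; unfold auxg; rw [Real.cos_add_pi, abs_neg]
  have e1 : ∫ t in π..(2*π), auxg a t = ∫ t in (-(π/2))..(π/2), auxg a t := by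
    have := hper.intervalIntegral_add_eq π (-(π/2))
    rwa [show π + π = 2*π by ring, show -(π/2)+π = π/2 by ring] at this
  have e2 : ∫ t in 0..π, auxg a t = ∫ t in (-(π/2))..(π/2), auxg a t := by
    have := hper.intervalIntegral_add_eq 0 (-(π/2))
    rwa [zero_add, show -(π/2)+π = π/2 by ring] at this
  have e3 : ∫ t in (-(π/2))..0, auxg a t = ∫ t in 0..(π/2), auxg a t := by
    have := intervalIntegral.integral_comp_neg (a := 0) (b := π/2) (auxg a)
    rw [neg_zero] at this
    rw [← this]
    congr 1; funext t; unfold auxg; rw [Real.cos_neg]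
  rw [← intervalIntegral.integral_add_adjacent_intervals (auxg_ii a ha 0 π) (auxg_ii a ha π _),
    e1, e2, ← intervalIntegral.integral_add_adjacent_intervals (auxg_ii a ha _ 0) (auxg_ii a ha 0 _),
    e3, auxg_quarter a ha ha1]
  ring

lemma aux_inner (R : ℝ) (hR : 0 < R) (v : ℝ) (hv : v ≠ 0) :
    ∫⁻ t, ENNReal.ofReal (if t ∈ Set.Icc (0:ℝ) (2 * π) then 1 / (2 * π) else 0) *
      (ENNReal.ofReal |(Real.cos t)⁻¹| *
        ENNReal.ofReal (if v / Real.cos t ∈ Set.Icc (-R) R then 1 / (2 * R) else 0))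
    = ENNReal.ofReal (if 0 < |v| ∧ |v| ≤ R then
            (1 / (π * R)) * (Real.log (1 + Real.sqrt (1 - (v / R) ^ 2))
              - Real.log (|v| / R)) else 0) := by
  have hpi := Real.pi_pos
  have hv0 : 0 < |v| := abs_pos.2 hv
  have ha : 0 < |v| / R := by positivity
  have key : ∫⁻ t, ENNReal.ofReal (if t ∈ Set.Icc (0:ℝ) (2 * π) then 1 / (2 * π) else 0) *
      (ENNReal.ofReal |(Real.cos t)⁻¹| *
        ENNReal.ofReal (if v / Real.cos t ∈ Set.Icc (-R) R then 1 / (2 * R) else 0))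
      = ∫⁻ t in Set.Ioc 0 (2*π), ENNReal.ofReal (1 / (4 * π * R) * auxg (|v|/R) t) := by
    rw [setLIntegral_congr Ioc_ae_eq_Icc, ← lintegral_indicator measurableSet_Icc]
    refine lintegral_congr_ae ?_
    filter_upwards [aux_ae_cos] with t ht
    by_cases h : t ∈ Set.Icc (0:ℝ) (2*π)
    · rw [if_pos h, Set.indicator_of_mem h, ← ENNReal.ofReal_mul (by positivity),
        ← ENNReal.ofReal_mul (by positivity)]
      congr 1
      have hct : 0 < |Real.cos t| := abs_pos.2 ht
      have hiff : v / Real.cos t ∈ Set.Icc (-R) R ↔ |v| / R ≤ |Real.cos t| := by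
        rw [Set.mem_Icc, ← abs_le, abs_div, div_le_iff₀ hct, div_le_iff₀ hR, mul_comm]
      unfold auxg
      by_cases h' : |v| / R ≤ |Real.cos t|
      · rw [if_pos h', if_pos (hiff.2 h'), abs_inv]
        field_simp
        norm_num
      · rw [if_neg h', if_neg (fun h => h' (hiff.1 h))]
        simp
    · rw [if_neg h, Set.indicator_of_notMem h]
      simp
  rw [key]
  by_cases hvR : |v| ≤ R
  · rw [if_pos ⟨hv0, hvR⟩]
    have hii := (auxg_ii (|v|/R) ha 0 (2*π)).const_mul (1 / (4 * π * R))
    rw [intervalIntegrable_iff_integrableOn_Ioc_of_le (by positivity)] at hii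
    rw [← ofReal_integral_eq_lintegral_ofReal hii
      (Eventually.of_forall fun t => mul_nonneg (by positivity) (auxg_nonneg _ _)),
      ← intervalIntegral.integral_of_le (by positivity), intervalIntegral.integral_const_mul,
      auxg_full _ ha ((div_le_one hR).2 hvR)]
    congr 1
    rw [div_pow, sq_abs, ← div_pow]
    field_simp
  · rw [if_neg (fun h => hvR h.2)]
    have : ∀ t, auxg (|v|/R) t = 0 := by
      intro t
      unfold auxg
      rw [if_neg]
      rw [not_le] at hvR ⊢
      exact (Real.abs_cos_le_one t).trans_lt ((one_lt_div hR).2 hvR)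
    simp [this]

/-- If `δr` is uniform on `[−r_max, r_max]` and `θ` is uniform on `[0, 2π]`,
independent of `δr`, then `V = δr cos θ` has density
`(1/(π r_max))(ln(1 + √(1 − (v/r_max)²)) − ln(|v|/r_max))` for `0 < |v| ≤ r_max` and `0`
for `|v| > r_max`. -/
theorem radial_error_density {Ω : Type*} [MeasurableSpace Ω]
    (μ : Measure Ω) [IsProbabilityMeasure μ]
    (rmax : ℝ) (hr : 0 < rmax) (δr θ : Ω → ℝ)
    (hmδr : Measurable δr) (hmθ : Measurable θ)
    (hindep : IndepFun δr θ μ)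
    (hδr : Measure.map δr μ = volume.withDensity (fun t => ENNReal.ofReal
      (if t ∈ Set.Icc (-rmax) rmax then 1 / (2 * rmax) else 0)))
    (hθ : Measure.map θ μ = volume.withDensity (fun t => ENNReal.ofReal
      (if t ∈ Set.Icc (0:ℝ) (2 * π) then 1 / (2 * π) else 0))) :
    Measure.map (fun ω => δr ω * Real.cos (θ ω)) μ
      = volume.withDensity (fun v => ENNReal.ofReal
          (if 0 < |v| ∧ |v| ≤ rmax then
            (1 / (π * rmax)) * (Real.log (1 + Real.sqrt (1 - (v / rmax) ^ 2))
              - Real.log (|v| / rmax))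
           else 0)) := by
  have hmf : Measurable (fun t : ℝ => ENNReal.ofReal
      (if t ∈ Set.Icc (-rmax) rmax then 1 / (2 * rmax) else 0)) :=
    (Measurable.ite measurableSet_Icc measurable_const measurable_const).ennreal_ofReal
  have hmq : Measurable (fun t : ℝ => ENNReal.ofReal
      (if t ∈ Set.Icc (0:ℝ) (2 * π) then 1 / (2 * π) else 0)) :=
    (Measurable.ite measurableSet_Icc measurable_const measurable_const).ennreal_ofReal
  have hinner := aux_inner rmax hr
  set f : ℝ → ENNReal := fun t : ℝ => ENNReal.ofReal
      (if t ∈ Set.Icc (-rmax) rmax then 1 / (2 * rmax) else 0) with hf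
  set q : ℝ → ENNReal := fun t : ℝ => ENNReal.ofReal
      (if t ∈ Set.Icc (0:ℝ) (2 * π) then 1 / (2 * π) else 0) with hq
  have hprod := (indepFun_iff_map_prod_eq_prod_map_map hmδr.aemeasurable hmθ.aemeasurable).1 hindep
  have hmV : Measurable (fun p : ℝ × ℝ => p.1 * Real.cos p.2) := by fun_prop
  have hmap : Measure.map (fun ω => δr ω * Real.cos (θ ω)) μ
      = Measure.map (fun p : ℝ × ℝ => p.1 * Real.cos p.2)
        ((Measure.map δr μ).prod (Measure.map θ μ)) := by
    rw [← hprod, Measure.map_map hmV (hmδr.prodMk hmθ)]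
    rfl
  have : IsProbabilityMeasure (Measure.map δr μ) := Measure.isProbabilityMeasure_map hmδr.aemeasurable
  have : IsProbabilityMeasure (Measure.map θ μ) := Measure.isProbabilityMeasure_map hmθ.aemeasurable
  ext A hA
  have hI : Measurable (A.indicator (1 : ℝ → ENNReal)) := measurable_one.indicator hA
  have hIV : Measurable fun p : ℝ × ℝ => A.indicator (1 : ℝ → ENNReal) (p.1 * Real.cos p.2) :=
    hI.comp hmV
  rw [hmap, ← lintegral_indicator_one hA, lintegral_map hI hmV,
    lintegral_prod_symm' _ hIV, hθ,
    lintegral_withDensity_eq_lintegral_mul _ hmq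
      (Measurable.lintegral_prod_left' hIV), hδr]
  have step : ∀ᵐ t : ℝ, (q * fun t => ∫⁻ r, A.indicator 1 (r * Real.cos t) ∂(volume.withDensity f)) t
      = ∫⁻ v, A.indicator 1 v * (q t * (ENNReal.ofReal |(Real.cos t)⁻¹| * f (v / Real.cos t))) := by
    filter_upwards [aux_ae_cos] with t ht
    have hF : Measurable fun v => f (v / Real.cos t) * A.indicator (1 : ℝ → ENNReal) v :=
      (hmf.comp (measurable_id.div_const _)).mul hI
    have hG : Measurable fun r : ℝ => A.indicator (1 : ℝ → ENNReal) (r * Real.cos t) :=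
      hI.comp (measurable_id.mul_const _)
    rw [Pi.mul_apply, lintegral_withDensity_eq_lintegral_mul _ hmf hG]
    have := aux_scale (Real.cos t) ht _ hF
    simp only [mul_div_cancel_right₀ _ ht] at this
    simp only [Pi.mul_apply]
    rw [this, ← lintegral_const_mul _ (hF.const_mul _)]
    refine lintegral_congr fun v => ?_
    ring
  rw [lintegral_congr_ae step, lintegral_lintegral_swap, withDensity_apply _ hA,
    ← lintegral_indicator hA]
  · refine lintegral_congr_ae ?_
    have hne : ∀ᵐ v : ℝ, v ≠ 0 := by simp [ae_iff]
    filter_upwards [hne] with v hv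
    have hm : Measurable fun t => q t * (ENNReal.ofReal |(Real.cos t)⁻¹| * f (v / Real.cos t)) := by
      refine hmq.mul (Measurable.mul (by fun_prop) (hmf.comp (by fun_prop)))
    rw [lintegral_const_mul _ hm, hinner v hv]
    by_cases hvA : v ∈ A <;> simp [hvA]
  · refine Measurable.aemeasurable ?_
    refine (hI.comp measurable_snd).mul ((hmq.comp measurable_fst).mul
      (Measurable.mul (by fun_prop) (hmf.comp (by fun_prop))))
end
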